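/- Let k be a field of characteristic 2 and k' = k(X₁, Y₁, X₂, Y₂) the rational function field in four variables. Consider the k'-quaternion algebras Q₁ = [X₁+X₂, Y₁)_{k'}, Q₂ = [X₁+X₂, Y₂)_{k'}, Q₃ = [X₁, Y₁Y₂)_{k'}, Q₄ = [X₂, Y₁Y₂)_{k'}, and Q = [X₁+X₂, Y₁Y₂)_{k'}. Then Q is a quaternion division algebra over k', and there are Brauer equivalences Q₁ ⊗_{k'} Q₂ ∼ Q ∼ Q₃ ⊗_{k'} Q₄. Moreover, setting B⁺ = [X₁, Y₂)_{k'} ⊗_{k'} [X₂, Y₁)_{k'} and B⁻ = [X₁, Y₁)_{k'} ⊗_{k'} [X₂, Y₂)_{k'}, the algebras B⁺ and B⁻ are division algebras over k' and B⁺ ⊗_{k'} B⁻ ∼ Q. -/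

import Mathlib

/-!  Common definitions for formalizing results of
"Triality over fields with I³ = 0" (F. K. Bingöl, A. Quéguiner-Mathieu).

We model an algebra with quadratic pair `(A, σ, f)` by the data of the reduced trace
`T` of `A` (given together with the property `IsReducedTrace` characterising it via a
splitting field), the involution `σ`, and an element `ℓ ∈ A` with `ℓ + σ(ℓ) = 1`; the
semi-trace is `f = f_ℓ : s ↦ T(ℓ s)`.  By [KMRT, (5.7)] every semi-trace is of this
form, so this is an equivalent description of quadratic pairs.  -/

open scoped TensorProduct
open Module

noncomputable section

namespace Triality

variable (F : Type) [CommRing F]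

/-- A (finite-dimensional) central simple algebra. -/
def IsCSA (A : Type) [Ring A] [Algebra F A] : Prop :=
  Algebra.IsCentral F A ∧ IsSimpleRing A ∧ Module.Finite F A

/-- The degree of a central simple algebra: the square root of its dimension. -/
def deg (A : Type) [Ring A] [Algebra F A] : ℕ := Nat.sqrt (Module.finrank F A)

/-- Brauer equivalence of two algebras. -/
def BrauerEquiv (A B : Type) [Ring A] [Algebra F A] [Ring B] [Algebra F B] : Prop :=
  ∃ n m : ℕ, 0 < n ∧ 0 < m ∧
    Nonempty (Matrix (Fin n) (Fin n) A ≃ₐ[F] Matrix (Fin m) (Fin m) B)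

/-- An algebra is split if it is isomorphic to a matrix algebra over the base. -/
def IsSplit (A : Type) [Ring A] [Algebra F A] : Prop :=
  ∃ n : ℕ, 0 < n ∧ Nonempty (A ≃ₐ[F] Matrix (Fin n) (Fin n) F)

/-- The Schur index of a central simple algebra: the smallest degree of a central
simple algebra in its Brauer class (realised by the underlying division algebra). -/
def schurIndex (A : Type) [Ring A] [Algebra F A] : ℕ :=
  sInf { d : ℕ | 0 < d ∧ ∃ (D : Type) (_ : Ring D) (_ : Algebra F D),
    IsCSA F D ∧ Module.finrank F D = d * d ∧ BrauerEquiv F A D }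

/-- A linear involution (anti-automorphism of period 2) on an algebra. -/
def IsInvolution {A : Type} [Ring A] [Algebra F A] (σ : A →ₗ[F] A) : Prop :=
  (∀ x y : A, σ (x * y) = σ y * σ x) ∧ (∀ x : A, σ (σ x) = x)

/-- `T` is the reduced trace of the central simple algebra `A`: over some splitting field
it is given by the trace of matrices. -/
def IsReducedTrace (A : Type) [Ring A] [Algebra F A] (T : A →ₗ[F] F) : Prop :=
  ∃ (E : Type) (_ : Field E) (_ : Algebra F E) (n : ℕ)
    (e : E ⊗[F] A ≃ₐ[E] Matrix (Fin n) (Fin n) E),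
    ∀ a : A, algebraMap F E (T a) = Matrix.trace (e ((1 : E) ⊗ₜ[F] a))

/-- The submodule of symmetric elements of an involution. -/
def symSet {A : Type} [Ring A] [Algebra F A] (σ : A →ₗ[F] A) : Submodule F A :=
  LinearMap.ker (σ - LinearMap.id)

/-- A quadratic pair on a central simple algebra `A` with reduced trace `T`, encoded
by the involution `σ` together with an element `ℓ` with `ℓ + σ(ℓ) = 1`; the semi-trace of
the pair is `f_ℓ : s ↦ T(ℓ s)` on symmetric elements. -/
def IsQuadraticPair (A : Type) [Ring A] [Algebra F A] (T : A →ₗ[F] F)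
    (σ : A →ₗ[F] A) (ℓ : A) : Prop :=
  IsInvolution F σ ∧
  2 * Module.finrank F (symSet F σ) = deg F A * (deg F A + 1) ∧
  (∀ x : A, σ x = -x → T x = 0) ∧
  ℓ + σ ℓ = 1

/-- A right ideal of `A`, as a submodule over the base. -/
def IsRightIdeal (A : Type) [Ring A] [Algebra F A] (I : Submodule F A) : Prop :=
  ∀ x ∈ I, ∀ a : A, x * a ∈ I

/-- An isotropic right ideal for the quadratic pair `(σ, f_ℓ)`:
`σ(I)·I = 0` and the semi-trace `f_ℓ = T(ℓ·)` vanishes on `I ∩ Sym(A,σ)`. -/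
def IsIsotropicIdeal (A : Type) [Ring A] [Algebra F A] (T : A →ₗ[F] F)
    (σ : A →ₗ[F] A) (ℓ : A) (I : Submodule F A) : Prop :=
  IsRightIdeal F A I ∧
  (∀ x ∈ I, ∀ y ∈ I, σ x * y = 0) ∧
  (∀ x ∈ I, σ x = x → T (ℓ * x) = 0)

/-- The algebra with quadratic pair `(A, σ, f_ℓ)` is isotropic. -/
def QPIsotropic (A : Type) [Ring A] [Algebra F A] (T : A →ₗ[F] F)
    (σ : A →ₗ[F] A) (ℓ : A) : Prop :=
  ∃ I : Submodule F A, IsIsotropicIdeal F A T σ ℓ I ∧ I ≠ ⊥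

/-- The algebra with quadratic pair `(A, σ, f_ℓ)` is hyperbolic. -/
def QPHyperbolic (A : Type) [Ring A] [Algebra F A] (T : A →ₗ[F] F)
    (σ : A →ₗ[F] A) (ℓ : A) : Prop :=
  ∃ I : Submodule F A, IsIsotropicIdeal F A T σ ℓ I ∧
    2 * Module.finrank F I = Module.finrank F A

/-- The index of an algebra with quadratic pair: the set of reduced dimensions
`dim_F I / deg A` of isotropic right ideals `I`. -/
def qpIndexSet (A : Type) [Ring A] [Algebra F A] (T : A →ₗ[F] F)
    (σ : A →ₗ[F] A) (ℓ : A) : Set ℕ :=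
  { r : ℕ | ∃ I : Submodule F A, IsIsotropicIdeal F A T σ ℓ I ∧
      Module.finrank F I = r * deg F A }

/-- A symplectic involution, characterised characteristic-freely: in characteristic 2,
`1` is an alternating element; in characteristic `≠ 2`, the symmetric elements have
dimension `n(n-1)/2`. -/
def IsSymplectic (A : Type) [Ring A] [Algebra F A] (σ : A →ₗ[F] A) : Prop :=
  IsInvolution F σ ∧
    ((ringChar F = 2 ∧ ∃ y : A, 1 = y + σ y) ∨
     (ringChar F ≠ 2 ∧ 2 * Module.finrank F (symSet F σ) = deg F A * (deg F A - 1)))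

/-- The sandwich map `Sand : A ⊗ A → End_F(A)`, `Sand(a ⊗ b)(x) = a x b`. -/
def sand (A : Type) [Ring A] [Algebra F A] : A ⊗[F] A →ₗ[F] A →ₗ[F] A :=
  TensorProduct.lift
    (LinearMap.mk₂ F (fun a b => (LinearMap.mulRight F b).comp (LinearMap.mulLeft F a))
      (fun a a' b => by ext x; simp [add_mul])
      (fun c a b => by ext x; simp [smul_mul_assoc])
      (fun a b b' => by ext x; simp [mul_add])
      (fun c a b => by ext x; simp [mul_smul_comm]))

/-- The degree-two part map `A ⊗ A → T(A)`, `a ⊗ b ↦ ι a * ι b`. -/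
def mu2 (A : Type) [Ring A] [Algebra F A] : A ⊗[F] A →ₗ[F] TensorAlgebra F A :=
  TensorProduct.lift
    (LinearMap.mk₂ F (fun a b => TensorAlgebra.ι F a * TensorAlgebra.ι F b)
      (fun a a' b => by simp [add_mul])
      (fun c a b => by simp [smul_mul_assoc])
      (fun a b b' => by simp [mul_add])
      (fun c a b => by simp [mul_smul_comm]))

/-- The defining relations of the Clifford algebra `C(A, σ, f)` of an algebra with
quadratic pair, following [KMRT, §8.B]: in the tensor algebra `T(A)`, a symmetric
element `s`, viewed in degree one, is identified with the scalar `f(s) = T(ℓ s)`, and a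
`σ₂`-symmetric element `c ∈ A ⊗ A` (i.e. `Sand(c) ∘ σ = Sand(c)`), viewed in degree two,
is identified with the degree-one element `Sand(c)(ℓ)`.  (In the split case
`A = End(V)`, `(σ, f) = ad(q)`, these are the Bichsel–Knus relations presenting
the even Clifford algebra `C₀(q)`.) -/
inductive CliffordRel (A : Type) [Ring A] [Algebra F A] (T : A →ₗ[F] F)
    (σ : A →ₗ[F] A) (ℓ : A) : TensorAlgebra F A → TensorAlgebra F A → Prop
  | sym (s : A) (hs : σ s = s) :
      CliffordRel A T σ ℓ (TensorAlgebra.ι F s) (algebraMap F _ (T (ℓ * s)))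
  | deg2 (c : A ⊗[F] A) (hc : ∀ x : A, sand F A c (σ x) = sand F A c x) :
      CliffordRel A T σ ℓ (mu2 F A c) (TensorAlgebra.ι F (sand F A c ℓ))

/-- The Clifford algebra of an algebra with quadratic pair [KMRT, §8.B]. -/
def CliffordAlg (A : Type) [Ring A] [Algebra F A] (T : A →ₗ[F] F)
    (σ : A →ₗ[F] A) (ℓ : A) : Type :=
  RingQuot (CliffordRel F A T σ ℓ)

instance (A : Type) [Ring A] [Algebra F A] (T : A →ₗ[F] F) (σ : A →ₗ[F] A) (ℓ : A) :
    Ring (CliffordAlg F A T σ ℓ) := inferInstanceAs (Ring (RingQuot _))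

instance (A : Type) [Ring A] [Algebra F A] (T : A →ₗ[F] F) (σ : A →ₗ[F] A) (ℓ : A) :
    Algebra F (CliffordAlg F A T σ ℓ) := inferInstanceAs (Algebra F (RingQuot _))

/-- The canonical image of `a ∈ A` as a degree-one element of the Clifford algebra. -/
def cliffGen (A : Type) [Ring A] [Algebra F A] (T : A →ₗ[F] F)
    (σ : A →ₗ[F] A) (ℓ : A) (a : A) : CliffordAlg F A T σ ℓ :=
  RingQuot.mkAlgHom F (CliffordRel F A T σ ℓ) (TensorAlgebra.ι F a)

/-- The quadratic pair `(σ, f)` has trivial discriminant: the centre of its Clifford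
algebra is the split étale quadratic algebra, i.e. contains a nontrivial idempotent. -/
def HasTrivialDiscriminant (A : Type) [Ring A] [Algebra F A] (T : A →ₗ[F] F)
    (σ : A →ₗ[F] A) (ℓ : A) : Prop :=
  ∃ e : CliffordAlg F A T σ ℓ, e ∈ Subalgebra.center F (CliffordAlg F A T σ ℓ) ∧
    e * e = e ∧ e ≠ 0 ∧ e ≠ 1

/-- `(A, σ)` (an algebra with involution) is a quadratic extension of the algebra with
unitary involution `(C, σ_C)`, where `uC` is a distinguished generator of the centre `K`
of `C` over `F`:  `C` embeds in `A` compatibly with the involutions, with image the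
centralizer of the image of `K`. -/
def IsInvQuadExt (A : Type) [Ring A] [Algebra F A] (σ : A →ₗ[F] A)
    (C : Type) [Ring C] [Algebra F C] (σC : C →ₗ[F] C) (uC : C) : Prop :=
  ∃ j : C →ₐ[F] A, Function.Injective j ∧ (∀ x : C, σ (j x) = j (σC x)) ∧
    (Set.range (j : C → A) = Set.centralizer {j uC})

/-- `(A, σ, f_ℓ)` (an algebra with quadratic pair) is a quadratic extension of the
algebra with unitary involution `(C, σ_C)`:  in addition to the conditions of
`IsInvQuadExt`, the semi-trace `f_ℓ` coincides on symmetric elements with `f_{ℓK}` for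
some generator `ℓK` of the quadratic étale algebra `K = F[j(uC)] ⊆ A` with
`ℓK² - ℓK ∈ F`. -/
def IsQPQuadExt (A : Type) [Ring A] [Algebra F A] (T : A →ₗ[F] F)
    (σ : A →ₗ[F] A) (ℓ : A)
    (C : Type) [Ring C] [Algebra F C] (σC : C →ₗ[F] C) (uC : C) : Prop :=
  ∃ j : C →ₐ[F] A, Function.Injective j ∧ (∀ x : C, σ (j x) = j (σC x)) ∧
    (Set.range (j : C → A) = Set.centralizer {j uC}) ∧
    ∃ ℓK ∈ Algebra.adjoin F ({j uC} : Set A),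
      ℓK ∉ Set.range (algebraMap F A) ∧
      (ℓK * ℓK - ℓK) ∈ Set.range (algebraMap F A) ∧
      ∀ s : A, σ s = s → T (ℓ * s) = T (ℓK * s)

/-- The algebra with unitary involution `(C, σ_C)` is isotropic: there is a nonzero
right ideal `J` with `σ_C(J)·J = 0`. -/
def UnitaryIsotropic (C : Type) [Ring C] [Algebra F C] (σC : C →ₗ[F] C) : Prop :=
  ∃ J : Submodule F C, IsRightIdeal F C J ∧ (∀ x ∈ J, ∀ y ∈ J, σC x * y = 0) ∧ J ≠ ⊥

/-- The algebra with unitary involution `(C, σ_C)` is hyperbolic: there is a right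
ideal `J` with `σ_C(J)·J = 0` of half the dimension (over `F`; equivalently, of half the
dimension over the centre). -/
def UnitaryHyperbolic (C : Type) [Ring C] [Algebra F C] (σC : C →ₗ[F] C) : Prop :=
  ∃ J : Submodule F C, IsRightIdeal F C J ∧ (∀ x ∈ J, ∀ y ∈ J, σC x * y = 0) ∧
    2 * Module.finrank F J = Module.finrank F C

/-- The 3-fold quadratic Pfister form `⟨⟨a, b, c]]` on `F⁸`. -/
def pfister3Form (a b c : F) : (Fin 8 → F) → F := fun v =>
  (v 0 * v 0 + v 0 * v 1 + c * (v 1 * v 1))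
  + a * (v 2 * v 2 + v 2 * v 3 + c * (v 3 * v 3))
  + b * (v 4 * v 4 + v 4 * v 5 + c * (v 5 * v 5))
  + a * b * (v 6 * v 6 + v 6 * v 7 + c * (v 7 * v 7))

/-- `I_q³ F = 0`: every 3-fold quadratic Pfister form over `F` is hyperbolic, i.e.
vanishes on a totally isotropic subspace of half the dimension. -/
def I3Trivial : Prop :=
  ∀ a b c : F, a ≠ 0 → b ≠ 0 → (1 : F) - 4 * c ≠ 0 →
    ∃ W : Submodule F (Fin 8 → F), Module.finrank F W = 4 ∧
      ∀ v ∈ W, pfister3Form F a b c v = 0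

/-- An algebra with quadratic pair, bundled. -/
structure QPAlgebra : Type 1 where
  A : Type
  [ring : Ring A]
  [alg : Algebra F A]
  T : A →ₗ[F] F
  σ : A →ₗ[F] A
  ℓ : A
  csa : IsCSA F A
  trd : IsReducedTrace F A T
  pair : IsQuadraticPair F A T σ ℓ

attribute [instance] QPAlgebra.ring QPAlgebra.alg

/-- A trialitarian triple: three degree-8 algebras with quadratic pair such that the
Clifford algebra of the first, with its canonical quadratic pair, is isomorphic to the
product of the other two.  The isomorphism intertwines the canonical involution of the
Clifford algebra (which maps the degree-one generator attached to `a` to the one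
attached to `σ(a)`) with the product involution; since the degree-one elements generate
the Clifford algebra, this is recorded on generators. -/
def IsTrialitarianTriple (X Y Z : QPAlgebra F) : Prop :=
  Module.finrank F X.A = 64 ∧ Module.finrank F Y.A = 64 ∧ Module.finrank F Z.A = 64 ∧
  ∃ φ : CliffordAlg F X.A X.T X.σ X.ℓ ≃ₐ[F] (Y.A × Z.A),
    ∀ a : X.A,
      φ (cliffGen F X.A X.T X.σ X.ℓ (X.σ a)) =
        (Y.σ (φ (cliffGen F X.A X.T X.σ X.ℓ a)).1,
         Z.σ (φ (cliffGen F X.A X.T X.σ X.ℓ a)).2)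

/-- A trialitarian triple is isotropic if one of its three members is isotropic
(equivalently, by triality, each of them is). -/
def TripleIsotropic (X Y Z : QPAlgebra F) : Prop :=
  QPIsotropic F X.A X.T X.σ X.ℓ ∨ QPIsotropic F Y.A Y.T Y.σ Y.ℓ ∨
    QPIsotropic F Z.A Z.T Z.σ Z.ℓ

/-- The (unordered) triple of Schur indices of a trialitarian triple; the index
`ind T = (a, b, c)` with `a ≤ b ≤ c` of the paper corresponds to this multiset being
`{a, b, c}`. -/
def indexMultiset (X Y Z : QPAlgebra F) : Multiset ℕ :=
  {schurIndex F X.A, schurIndex F Y.A, schurIndex F Z.A}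

/-- The relations of the quaternion algebra `[a, b)_F = F⟨i, j⟩` with
`i² - i = a`, `j² = b`, `ji = (1 - i)j`. -/
inductive QuatRel (a b : F) : FreeAlgebra F (Fin 2) → FreeAlgebra F (Fin 2) → Prop
  | ii : QuatRel a b (FreeAlgebra.ι F 0 * FreeAlgebra.ι F 0)
      (FreeAlgebra.ι F 0 + algebraMap F _ a)
  | jj : QuatRel a b (FreeAlgebra.ι F 1 * FreeAlgebra.ι F 1) (algebraMap F _ b)
  | ji : QuatRel a b (FreeAlgebra.ι F 1 * FreeAlgebra.ι F 0)
      ((1 - FreeAlgebra.ι F 0) * FreeAlgebra.ι F 1)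

/-- The quaternion algebra `[a, b)_F`, presented by generators and relations. -/
def QuatAlg (a b : F) : Type := RingQuot (QuatRel F a b)

instance (a b : F) : Ring (QuatAlg F a b) := inferInstanceAs (Ring (RingQuot _))
instance (a b : F) : Algebra F (QuatAlg F a b) := inferInstanceAs (Algebra F (RingQuot _))

/-- A ring in which every nonzero element is invertible. -/
def IsDivision (A : Type) [Ring A] : Prop := ∀ x : A, x ≠ 0 → IsUnit x

end Triality

end

namespace Triality

noncomputable section

variable (k : Type) [Field k]

/-- The rational function field `k' = k(X₁, Y₁, X₂, Y₂)`. -/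
def RatFun4 : Type := FractionRing (MvPolynomial (Fin 4) k)

instance : Field (RatFun4 k) := inferInstanceAs (Field (FractionRing _))
instance : Algebra (MvPolynomial (Fin 4) k) (RatFun4 k) :=
  inferInstanceAs (Algebra _ (FractionRing _))

/-- The variables `X₁, Y₁, X₂, Y₂` of `k' = k(X₁, Y₁, X₂, Y₂)`:
`var 0 = X₁`, `var 1 = Y₁`, `var 2 = X₂`, `var 3 = Y₂`. -/
def var (i : Fin 4) : RatFun4 k :=
  algebraMap (MvPolynomial (Fin 4) k) (RatFun4 k) (MvPolynomial.X i)

namespace QuatAlg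

variable {F : Type} [Field F] {a b c d : F}

variable (a b) in
/-- The canonical generator `i` of `[a, b)_F`. -/
def genI : QuatAlg F a b := RingQuot.mkAlgHom F (QuatRel F a b) (FreeAlgebra.ι F 0)

variable (a b) in
/-- The canonical generator `j` of `[a, b)_F`. -/
def genJ : QuatAlg F a b := RingQuot.mkAlgHom F (QuatRel F a b) (FreeAlgebra.ι F 1)

theorem genI_mul_genI : genI a b * genI a b = genI a b + algebraMap F _ a := by
  have h := RingQuot.mkAlgHom_rel F (QuatRel.ii (a := a) (b := b))
  rw [map_mul, map_add, AlgHom.commutes] at h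
  exact h

theorem genJ_mul_genJ : genJ a b * genJ a b = algebraMap F _ b := by
  have h := RingQuot.mkAlgHom_rel F (QuatRel.jj (a := a) (b := b))
  rw [map_mul, AlgHom.commutes] at h
  exact h

theorem genJ_mul_genI : genJ a b * genI a b = (1 - genI a b) * genJ a b := by
  have h := RingQuot.mkAlgHom_rel F (QuatRel.ji (a := a) (b := b))
  rw [map_mul, map_mul, map_sub, map_one] at h
  exact h

section lift

variable {A : Type*} [Ring A] [Algebra F A]

/-- The universal property of `[a, b)_F`. -/
def lift (x y : A) (hx : x * x = x + algebraMap F A a) (hy : y * y = algebraMap F A b)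
    (hyx : y * x = (1 - x) * y) : QuatAlg F a b →ₐ[F] A :=
  RingQuot.liftAlgHom F ⟨FreeAlgebra.lift F ![x, y], by
    intro u v h
    cases h <;> simp [hx, hy, hyx]⟩

variable {x y : A} {hx : x * x = x + algebraMap F A a} {hy : y * y = algebraMap F A b}
  {hyx : y * x = (1 - x) * y}

@[simp]
theorem lift_genI : lift x y hx hy hyx (genI a b) = x :=
  (RingQuot.liftAlgHom_mkAlgHom_apply ..).trans (by simp)

@[simp]
theorem lift_genJ : lift x y hx hy hyx (genJ a b) = y :=
  (RingQuot.liftAlgHom_mkAlgHom_apply ..).trans (by simp)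

theorem algHom_ext {f g : QuatAlg F a b →ₐ[F] A} (hi : f (genI a b) = g (genI a b))
    (hj : f (genJ a b) = g (genJ a b)) : f = g := by
  refine RingQuot.ringQuot_ext' (S := F) (s := QuatRel F a b) f g (FreeAlgebra.hom_ext ?_)
  ext n
  fin_cases n
  exacts [hi, hj]

end lift

variable (a b) in
/-- The presented algebra `[a, b)_F` is Mathlib's quaternion algebra with parameters `a, 1, b`. -/
def equivQuaternionAlgebra : QuatAlg F a b ≃ₐ[F] QuaternionAlgebra F a 1 b :=
  AlgEquiv.ofAlgHom
    (lift ⟨0, 1, 0, 0⟩ ⟨0, 0, 1, 0⟩ (by ext <;> simp) (by ext <;> simp) (by ext <;> simp))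
    (QuaternionAlgebra.Basis.liftHom
      { i := genI a b
        j := genJ a b
        k := genI a b * genJ a b
        i_mul_i := by rw [genI_mul_genI, one_smul, Algebra.algebraMap_eq_smul_one, add_comm]
        j_mul_j := by rw [genJ_mul_genJ, Algebra.algebraMap_eq_smul_one]
        i_mul_j := rfl
        j_mul_i := by rw [genJ_mul_genI, one_smul, sub_mul, one_mul] })
    (by apply QuaternionAlgebra.hom_ext <;> simp [QuaternionAlgebra.Basis.lift])
    (by apply algHom_ext <;> simp [QuaternionAlgebra.Basis.lift])

instance : Module.Finite F (QuatAlg F a b) :=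
  Module.Finite.equiv (equivQuaternionAlgebra a b).symm.toLinearEquiv

theorem finrank_eq_four : Module.finrank F (QuatAlg F a b) = 4 :=
  (equivQuaternionAlgebra a b).toLinearEquiv.finrank_eq.trans
    (QuaternionAlgebra.finrank_eq_four ..)

theorem exists_eq (q : QuatAlg F a b) : ∃ r₀ r₁ r₂ r₃ : F,
    q = r₀ • 1 + r₁ • genI a b + r₂ • genJ a b + r₃ • (genI a b * genJ a b) := by
  obtain ⟨h, rfl⟩ := (equivQuaternionAlgebra a b).symm.surjective q
  exact ⟨h.re, h.imI, h.imJ, h.imK, by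
    rw [← Algebra.algebraMap_eq_smul_one]; rfl⟩

theorem commute_of_generators {A : Type*} [Ring A] [Algebra F A] (g : QuatAlg F a b →ₐ[F] A)
    {x : A} (hi : Commute x (g (genI a b))) (hj : Commute x (g (genJ a b)))
    (q : QuatAlg F a b) : Commute x (g q) := by
  obtain ⟨r₀, r₁, r₂, r₃, rfl⟩ := exists_eq q
  simp only [map_add, map_smul, map_mul, map_one]
  exact ((((Commute.one_right x).smul_right r₀).add_right (hi.smul_right r₁)).add_right
    (hj.smul_right r₂)).add_right ((hi.mul_right hj).smul_right r₃)

/-- In characteristic two, `1, i, j, ij` are independent over every commuting set of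
coefficients. -/
theorem coeff_eq_zero {S : Type*} [Ring S] (h2 : (2 : S) = 0) {i j : S}
    (hji : j * i = (1 - i) * j) (hj : IsUnit j) {a₀ a₁ a₂ a₃ : S}
    (hi₀ : Commute a₀ i) (hi₁ : Commute a₁ i) (hi₂ : Commute a₂ i) (hi₃ : Commute a₃ i)
    (hj₀ : Commute a₀ j) (hj₁ : Commute a₁ j) (hj₂ : Commute a₂ j) (hj₃ : Commute a₃ j)
    (h : a₀ + a₁ * i + a₂ * j + a₃ * (i * j) = 0) : a₀ = 0 ∧ a₁ = 0 ∧ a₂ = 0 ∧ a₃ = 0 := by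
  have key : ∀ {u v : S}, Commute u i → Commute v i → u + v * j = 0 → u = 0 ∧ v = 0 := by
    intro u v hu hv e
    have hs : v * (1 - 2 * i) * j = 0 := by
      have e' : (u + v * j) * i - i * (u + v * j) = v * (1 - 2 * i) * j := by
        rw [add_mul, mul_add, hu.eq, mul_assoc v j i, hji, ← mul_assoc i v j, ← hv.eq]
        noncomm_ring
      rw [← e', e, zero_mul, mul_zero, sub_zero]
    rw [h2, zero_mul, sub_zero, mul_one, hj.mul_left_eq_zero] at hs
    refine ⟨?_, hs⟩
    rwa [hs, zero_mul, add_zero] at e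
  have h₁₃ : a₁ + a₃ * j = 0 := by
    have e : j * (a₀ + a₁ * i + a₂ * j + a₃ * (i * j)) -
        (a₀ + a₁ * i + a₂ * j + a₃ * (i * j)) * j =
          (a₁ * (1 - 2 * i) + a₃ * (1 - 2 * i) * j) * j := by
      have e₁ : j * (a₁ * i) = a₁ * ((1 - i) * j) := by
        rw [← mul_assoc, ← hj₁.eq, mul_assoc, hji]
      have e₃ : j * (a₃ * (i * j)) = a₃ * ((1 - i) * j * j) := by
        rw [← mul_assoc, ← hj₃.eq, mul_assoc, ← mul_assoc j i j, hji]
      have e₂ : j * (a₂ * j) = a₂ * j * j := by rw [← mul_assoc, ← hj₂.eq]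
      rw [mul_add, mul_add, mul_add, e₁, e₂, e₃, ← hj₀.eq]
      noncomm_ring
    rw [h, mul_zero, zero_mul, sub_zero, h2, zero_mul, sub_zero, mul_one, mul_one] at e
    exact (hj.mul_left_eq_zero).1 e.symm
  obtain ⟨h₁, h₃⟩ := key hi₁ hi₃ h₁₃
  rw [h₁, h₃, zero_mul, zero_mul, add_zero, add_zero] at h
  obtain ⟨h₀, h₂⟩ := key hi₀ hi₂ h
  exact ⟨h₀, h₁, h₂, h₃⟩

theorem map_genJ_mul_map_genI {S : Type*} [Ring S] [Algebra F S] (g : QuatAlg F a b →ₐ[F] S) :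
    g (genJ a b) * g (genI a b) = (1 - g (genI a b)) * g (genJ a b) := by
  rw [← map_mul, genJ_mul_genI, map_mul, map_sub, map_one]

theorem isUnit_map_genJ {S : Type*} [Ring S] [Algebra F S] (g : QuatAlg F a b →ₐ[F] S)
    (hb : b ≠ 0) : IsUnit (g (genJ a b)) := by
  have h : g (genJ a b) * g (genJ a b) = algebraMap F S b := by
    rw [← map_mul, genJ_mul_genJ, AlgHom.commutes]
  rw [← isUnit_pow_iff two_ne_zero, pow_two, h]
  exact hb.isUnit.map (algebraMap F S)

theorem exists_eq_tmul {A : Type*} [Ring A] [Algebra F A] (t : A ⊗[F] QuatAlg F a b) :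
    ∃ x₀ x₁ x₂ x₃ : A, t = x₀ ⊗ₜ 1 + x₁ ⊗ₜ genI a b + x₂ ⊗ₜ genJ a b +
      x₃ ⊗ₜ (genI a b * genJ a b) := by
  induction t with
  | zero => exact ⟨0, 0, 0, 0, by simp⟩
  | tmul x q =>
    obtain ⟨r₀, r₁, r₂, r₃, rfl⟩ := exists_eq q
    exact ⟨r₀ • x, r₁ • x, r₂ • x, r₃ • x, by simp [TensorProduct.tmul_add,
      TensorProduct.smul_tmul]⟩
  | add t u ht hu =>
    obtain ⟨x₀, x₁, x₂, x₃, rfl⟩ := ht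
    obtain ⟨y₀, y₁, y₂, y₃, rfl⟩ := hu
    exact ⟨x₀ + y₀, x₁ + y₁, x₂ + y₂, x₃ + y₃, by simp only [TensorProduct.add_tmul]; abel⟩

theorem finrank_tensor : Module.finrank F (QuatAlg F a b ⊗[F] QuatAlg F c d) = 16 := by
  rw [Module.finrank_tensorProduct, finrank_eq_four, finrank_eq_four]

variable [CharP F 2] {S : Type*} [Ring S] [Algebra F S]

theorem two_eq_zero_of_charTwo (F : Type) [Field F] [CharP F 2] (S : Type*) [Ring S]
    [Algebra F S] : (2 : S) = 0 := by
  rw [← map_ofNat (algebraMap F S) 2, CharTwo.two_eq_zero, map_zero]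

theorem injective_of_algHom [Nontrivial S] (g : QuatAlg F a b →ₐ[F] S) (hb : b ≠ 0) :
    Function.Injective g := by
  refine (injective_iff_map_eq_zero g).2 fun q hq => ?_
  obtain ⟨r₀, r₁, r₂, r₃, rfl⟩ := exists_eq q
  simp only [map_add, map_mul, Algebra.smul_def, mul_one, AlgHom.commutes] at hq
  have hc := fun (r : F) (s : S) => Algebra.commute_algebraMap_left r s
  obtain ⟨h₀, h₁, h₂, h₃⟩ := coeff_eq_zero (two_eq_zero_of_charTwo F S)
    (map_genJ_mul_map_genI g) (isUnit_map_genJ g hb) (hc _ _) (hc _ _) (hc _ _) (hc _ _)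
    (hc _ _) (hc _ _) (hc _ _) (hc _ _) hq
  rw [map_eq_zero] at h₀ h₁ h₂ h₃
  simp [h₀, h₁, h₂, h₃]

theorem injective_tensorLift {A : Type*} [Ring A] [Algebra F A] (f : A →ₐ[F] S)
    (hf : Function.Injective f) (g : QuatAlg F a b →ₐ[F] S) (hb : b ≠ 0)
    (hfg : ∀ x q, Commute (f x) (g q)) :
    Function.Injective (Algebra.TensorProduct.lift f g hfg) := by
  refine (injective_iff_map_eq_zero _).2 fun t ht => ?_
  obtain ⟨x₀, x₁, x₂, x₃, rfl⟩ := exists_eq_tmul t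
  simp only [map_add, Algebra.TensorProduct.lift_tmul, map_one, mul_one, map_mul] at ht
  obtain ⟨h₀, h₁, h₂, h₃⟩ := coeff_eq_zero (two_eq_zero_of_charTwo F S)
    (map_genJ_mul_map_genI g) (isUnit_map_genJ g hb) (hfg _ _) (hfg _ _) (hfg _ _) (hfg _ _)
    (hfg _ _) (hfg _ _) (hfg _ _) (hfg _ _) ht
  rw [map_eq_zero_iff f hf] at h₀ h₁ h₂ h₃
  simp [h₀, h₁, h₂, h₃]

theorem exists_injective_tensor [Nontrivial S] (hb : b ≠ 0) (hd : d ≠ 0) {x y u v : S}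
    (hx : x * x = x + algebraMap F S a) (hy : y * y = algebraMap F S b)
    (hyx : y * x = (1 - x) * y) (hu : u * u = u + algebraMap F S c)
    (hv : v * v = algebraMap F S d) (hvu : v * u = (1 - u) * v)
    (hxu : Commute x u) (hxv : Commute x v) (hyu : Commute y u) (hyv : Commute y v) :
    ∃ h : QuatAlg F a b ⊗[F] QuatAlg F c d →ₐ[F] S, Function.Injective h := by
  let f := lift x y hx hy hyx
  let g := lift u v hu hv hvu
  refine ⟨_, injective_tensorLift f (injective_of_algHom f hb) g hd fun _ q =>
    (commute_of_generators f (commute_of_generators g ?_ ?_ q).symm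
      (commute_of_generators g ?_ ?_ q).symm _).symm⟩
  all_goals simpa [f, g]

theorem nonempty_tensor_algEquiv [Module.Finite F S] (hS : Module.finrank F S = 16)
    (hb : b ≠ 0) (hd : d ≠ 0) {x y u v : S}
    (hx : x * x = x + algebraMap F S a) (hy : y * y = algebraMap F S b)
    (hyx : y * x = (1 - x) * y) (hu : u * u = u + algebraMap F S c)
    (hv : v * v = algebraMap F S d) (hvu : v * u = (1 - u) * v)
    (hxu : Commute x u) (hxv : Commute x v) (hyu : Commute y u) (hyv : Commute y v) :
    Nonempty (QuatAlg F a b ⊗[F] QuatAlg F c d ≃ₐ[F] S) := by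
  have : Nontrivial S := Module.nontrivial_of_finrank_pos (R := F) (by omega)
  obtain ⟨h, hh⟩ := exists_injective_tensor hb hd hx hy hyx hu hv hvu hxu hxv hyu hyv
  exact ⟨AlgEquiv.ofBijective h ⟨hh, (LinearMap.injective_iff_surjective_of_finrank_eq_finrank
    (f := h.toLinearMap) (finrank_tensor.trans hS.symm)).1 hh⟩⟩

end QuatAlg

section BrauerEquiv

variable (F : Type) [Field F]

/-- `A` is isomorphic to a full matrix algebra over `B`. -/
def IsMatrixAlgOver (A B : Type) [Ring A] [Algebra F A] [Ring B] [Algebra F B] : Prop :=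
  ∃ n : ℕ, 0 < n ∧ Nonempty (A ≃ₐ[F] Matrix (Fin n) (Fin n) B)

/-- One-by-one matrices over `A` form a copy of `A`. -/
def matrixFinOneEquiv (A : Type) [Ring A] [Algebra F A] : Matrix (Fin 1) (Fin 1) A ≃ₐ[F] A where
  __ := Matrix.uniqueEquiv
  map_mul' M N := by simp [Matrix.mul_apply]
  map_add' M N := rfl
  commutes' r := by simp [Matrix.algebraMap_matrix_apply]

namespace IsMatrixAlgOver

variable {F} {A B C D : Type} [Ring A] [Algebra F A] [Ring B] [Algebra F B] [Ring C] [Algebra F C]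
  [Ring D] [Algebra F D]

theorem brauerEquiv (h : IsMatrixAlgOver F A B) : BrauerEquiv F A B := by
  obtain ⟨n, hn, ⟨e⟩⟩ := h
  exact ⟨1, n, one_pos, hn, ⟨(matrixFinOneEquiv F A).trans e⟩⟩

theorem trans (h₁ : IsMatrixAlgOver F A B) (h₂ : IsMatrixAlgOver F B C) :
    IsMatrixAlgOver F A C := by
  obtain ⟨m, hm, ⟨e⟩⟩ := h₁
  obtain ⟨n, hn, ⟨f⟩⟩ := h₂
  exact ⟨m * n, Nat.mul_pos hm hn, ⟨((e.trans f.mapMatrix).trans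
    (Matrix.compAlgEquiv (Fin m) (Fin n) C F)).trans
      (Matrix.reindexAlgEquiv F C finProdFinEquiv)⟩⟩

theorem tensor (h₁ : IsMatrixAlgOver F A B) (h₂ : IsMatrixAlgOver F C D) :
    IsMatrixAlgOver F (A ⊗[F] C) (B ⊗[F] D) := by
  obtain ⟨m, hm, ⟨e⟩⟩ := h₁
  obtain ⟨n, hn, ⟨f⟩⟩ := h₂
  exact ⟨m * n, Nat.mul_pos hm hn, ⟨((Algebra.TensorProduct.congr e f).trans
    (Matrix.kroneckerTMulAlgEquiv (Fin m) (Fin n) F F B D)).trans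
      (Matrix.reindexAlgEquiv F _ finProdFinEquiv)⟩⟩

theorem of_algEquiv (e : A ≃ₐ[F] B) : IsMatrixAlgOver F A B :=
  ⟨1, one_pos, ⟨e.trans (matrixFinOneEquiv F B).symm⟩⟩

theorem tensor_of_isSplit (h : IsSplit F C) : IsMatrixAlgOver F (A ⊗[F] C) A :=
  ((of_algEquiv AlgEquiv.refl).tensor h).trans
    (of_algEquiv (Algebra.TensorProduct.rid F F A))

end IsMatrixAlgOver

end BrauerEquiv

namespace QuatAlg

variable {F : Type} [Field F] {a a' b c : F}

theorem tmul_algebraMap {A B : Type*} [Ring A] [Algebra F A] [Ring B] [Algebra F B] (r s : F) :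
    (algebraMap F A r) ⊗ₜ[F] (algebraMap F B s) = algebraMap F (A ⊗[F] B) (s * r) := by
  simp [Algebra.algebraMap_eq_smul_one, TensorProduct.smul_tmul', smul_smul,
    Algebra.TensorProduct.one_def]

theorem one_tmul_algebraMap {A B : Type*} [Ring A] [Algebra F A] [Ring B] [Algebra F B] (s : F) :
    (1 : A) ⊗ₜ[F] (algebraMap F B s) = algebraMap F (A ⊗[F] B) s := by
  rw [← map_one (algebraMap F A), tmul_algebraMap, mul_one]

variable [CharP F 2]

theorem isSplit_of_algHom (hb : b ≠ 0) (g : QuatAlg F a b →ₐ[F] Matrix (Fin 2) (Fin 2) F) :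
    IsSplit F (QuatAlg F a b) :=
  ⟨2, two_pos, ⟨AlgEquiv.ofBijective g ⟨injective_of_algHom g hb,
    (LinearMap.injective_iff_surjective_of_finrank_eq_finrank (f := g.toLinearMap)
      (finrank_eq_four.trans (by simp [Module.finrank_matrix]))).1 (injective_of_algHom g hb)⟩⟩⟩

theorem isSplit_zero (hb : b ≠ 0) : IsSplit F (QuatAlg F 0 b) :=
  isSplit_of_algHom hb (lift !![1, 0; 0, 0] !![0, b; 1, 0]
    (by ext i j; fin_cases i <;> fin_cases j <;> simp)
    (by ext i j; fin_cases i <;> fin_cases j <;> simp [Matrix.algebraMap_matrix_apply])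
    (by ext i j; fin_cases i <;> fin_cases j <;> simp [Matrix.mul_apply]))

theorem isSplit_mul_self (hb : b ≠ 0) : IsSplit F (QuatAlg F a (b * b)) :=
  isSplit_of_algHom (mul_ne_zero hb hb) (lift !![0, a; 1, 1] !![b, b; 0, -b]
    (by ext i j; fin_cases i <;> fin_cases j <;> simp [Matrix.algebraMap_matrix_apply, add_comm])
    (by ext i j; fin_cases i <;> fin_cases j <;> simp [Matrix.algebraMap_matrix_apply])
    (by ext i j; fin_cases i <;> fin_cases j <;> simp [Matrix.mul_apply]; ring))

theorem charTwo_tensor : CharP (QuatAlg F a b ⊗[F] QuatAlg F a' c) 2 :=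
  have : Nontrivial (QuatAlg F a b ⊗[F] QuatAlg F a' c) :=
    Module.nontrivial_of_finrank_pos (R := F) (by rw [finrank_tensor]; norm_num)
  charP_of_injective_algebraMap (algebraMap F _).injective 2

theorem isMatrixAlgOver_tensor_left (hb : b ≠ 0) (hc : c ≠ 0) :
    IsMatrixAlgOver F (QuatAlg F a b ⊗[F] QuatAlg F a c) (QuatAlg F a (b * c)) := by
  have := charTwo_tensor (F := F) (a := a) (b := b) (a' := a) (c := c)
  have h2 (x : QuatAlg F a b ⊗[F] QuatAlg F a c) : x + x = 0 := CharTwo.add_self_eq_zero x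
  obtain ⟨e⟩ := nonempty_tensor_algEquiv (S := QuatAlg F a b ⊗[F] QuatAlg F a c)
    (a := a) (b := b * c) (c := 0) (d := c) (x := genI a b ⊗ₜ 1) (y := genJ a b ⊗ₜ genJ a c)
    (u := genI a b ⊗ₜ 1 + 1 ⊗ₜ genI a c) (v := 1 ⊗ₜ genJ a c)
    finrank_tensor (mul_ne_zero hb hc) hc
    (by simp [genI_mul_genI, TensorProduct.add_tmul, Algebra.TensorProduct.algebraMap_apply])
    (by simp [genJ_mul_genJ, tmul_algebraMap, mul_comm])
    (by simp [genJ_mul_genI, sub_mul, TensorProduct.sub_tmul])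
    (by
      simp only [mul_add, add_mul, Algebra.TensorProduct.tmul_mul_tmul, genI_mul_genI, mul_one,
        one_mul, TensorProduct.add_tmul, TensorProduct.tmul_add, one_tmul_algebraMap,
        ← Algebra.TensorProduct.algebraMap_apply, map_zero, add_zero]
      linear_combination (norm := abel) h2 (genI a b ⊗ₜ genI a c) + h2 (algebraMap F _ a))
    (by simp [genJ_mul_genJ, one_tmul_algebraMap])
    (by
      simp only [genJ_mul_genI, CharTwo.sub_eq_add, Algebra.TensorProduct.tmul_mul_tmul, mul_add,
        add_mul, TensorProduct.tmul_sub, sub_mul, one_mul, mul_one]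
      abel)
    (by simp [commute_iff_eq, mul_add, add_mul])
    (by simp [commute_iff_eq])
    (by
      simp only [commute_iff_eq, mul_add, add_mul, Algebra.TensorProduct.tmul_mul_tmul,
        genJ_mul_genI, sub_mul, one_mul, mul_one, TensorProduct.tmul_sub, TensorProduct.sub_tmul,
        CharTwo.sub_eq_add]
      linear_combination (norm := abel) h2 (genJ a b ⊗ₜ genJ a c))
    (by simp [commute_iff_eq])
  exact (IsMatrixAlgOver.of_algEquiv e.symm).trans (.tensor_of_isSplit (isSplit_zero hc))

theorem isMatrixAlgOver_tensor_right (hb : b ≠ 0) :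
    IsMatrixAlgOver F (QuatAlg F a b ⊗[F] QuatAlg F a' b) (QuatAlg F (a + a') b) := by
  have := charTwo_tensor (F := F) (a := a) (b := b) (a' := a') (c := b)
  have h2 (x : QuatAlg F a b ⊗[F] QuatAlg F a' b) : x + x = 0 := CharTwo.add_self_eq_zero x
  obtain ⟨e⟩ := nonempty_tensor_algEquiv (S := QuatAlg F a b ⊗[F] QuatAlg F a' b)
    (a := a + a') (b := b) (c := a') (d := b * b) (x := genI a b ⊗ₜ 1 + 1 ⊗ₜ genI a' b)
    (y := genJ a b ⊗ₜ 1) (u := 1 ⊗ₜ genI a' b) (v := genJ a b ⊗ₜ genJ a' b)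
    finrank_tensor hb (mul_ne_zero hb hb)
    (by
      simp only [mul_add, add_mul, Algebra.TensorProduct.tmul_mul_tmul, genI_mul_genI, mul_one,
        one_mul, TensorProduct.add_tmul, TensorProduct.tmul_add, one_tmul_algebraMap,
        ← Algebra.TensorProduct.algebraMap_apply, map_add]
      linear_combination (norm := abel) h2 (genI a b ⊗ₜ genI a' b))
    (by simp [genJ_mul_genJ, Algebra.TensorProduct.algebraMap_apply])
    (by
      simp only [genJ_mul_genI, CharTwo.sub_eq_add, Algebra.TensorProduct.tmul_mul_tmul, mul_add,
        add_mul, TensorProduct.sub_tmul, sub_mul, one_mul, mul_one]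
      abel)
    (by simp [genI_mul_genI, TensorProduct.tmul_add, one_tmul_algebraMap])
    (by simp [genJ_mul_genJ, tmul_algebraMap])
    (by simp [genJ_mul_genI, sub_mul, TensorProduct.tmul_sub])
    (by simp [commute_iff_eq, mul_add, add_mul])
    (by
      simp only [commute_iff_eq, mul_add, add_mul, Algebra.TensorProduct.tmul_mul_tmul,
        genJ_mul_genI, sub_mul, one_mul, mul_one, TensorProduct.tmul_sub, TensorProduct.sub_tmul,
        CharTwo.sub_eq_add]
      linear_combination (norm := abel) -h2 (genJ a b ⊗ₜ genJ a' b))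
    (by simp [commute_iff_eq])
    (by simp [commute_iff_eq])
  exact (IsMatrixAlgOver.of_algEquiv e.symm).trans (.tensor_of_isSplit (isSplit_mul_self hb))

theorem isMatrixAlgOver_tensor_tensor (hb : b ≠ 0) (hc : c ≠ 0) :
    IsMatrixAlgOver F
      ((QuatAlg F a c ⊗[F] QuatAlg F a' b) ⊗[F] (QuatAlg F a b ⊗[F] QuatAlg F a' c))
      (QuatAlg F (a + a') (b * c)) := by
  have h := (isMatrixAlgOver_tensor_left (F := F) (a := a) hc hb).tensor
    (isMatrixAlgOver_tensor_left (F := F) (a := a') hb hc)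
  rw [mul_comm c b] at h
  exact ((IsMatrixAlgOver.of_algEquiv
    (Algebra.TensorProduct.tensorTensorTensorComm F F F F _ _ _ _)).trans h).trans
      (isMatrixAlgOver_tensor_right (mul_ne_zero hb hc))

end QuatAlg

section Division

theorem isDivision_of_injective {F : Type} [Field F] {A : Type} [Ring A] [Algebra F A]
    [Module.Finite F A] {S : Type*} [Ring S] [Algebra F S] [IsDomain S] (h : A →ₐ[F] S)
    (hh : Function.Injective h) : IsDivision A := fun x hx => by
  have := hh.isDomain h
  let := divisionRingOfFiniteDimensional F A
  exact IsUnit.mk0 x hx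

/-- A domain with a central domain `P` inside it embeds into a domain which is an algebra over the
fraction field of `P`. -/
theorem exists_isDomain_algebra_fractionRing {P F R : Type} [CommRing P] [IsDomain P] [Field F]
    [Algebra P F] [IsFractionRing P F] [Ring R] [IsDomain R] (φ : P →+* R)
    (hφ : Function.Injective φ) (hc : ∀ p r, Commute (φ p) r) :
    ∃ (S : Type) (_ : Ring S) (_ : Algebra F S) (_ : IsDomain S) (ι : R →+* S),
      ∀ p, ι (φ p) = algebraMap F S (algebraMap P F p) := by
  let : Algebra P R := φ.toAlgebra' hc
  have hsmul (p : P) (r : R) : p • r = φ p * r := Algebra.smul_def p r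
  let ι : R →ₐ[P] F ⊗[P] R := Algebra.TensorProduct.includeRight
  have : IsLocalizedModule (nonZeroDivisors P) ι.toLinearMap :=
    inferInstanceAs (IsLocalizedModule _ (TensorProduct.mk P F R 1))
  have hι : Function.Injective ι := by
    refine (injective_iff_map_eq_zero ι).2 fun r hr => ?_
    obtain ⟨⟨p, hp⟩, h⟩ := (IsLocalizedModule.eq_zero_iff (nonZeroDivisors P) ι.toLinearMap).1 hr
    have h' : φ p * r = 0 := (hsmul p r).symm.trans h
    refine (mul_eq_zero.1 h').resolve_left ?_
    rw [map_eq_zero_iff φ hφ]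
    exact nonZeroDivisors.ne_zero hp
  have hfrac (s : F ⊗[P] R) : ∃ p : P, p ≠ 0 ∧ ∃ r, p • s = ι r := by
    obtain ⟨⟨r, p, hp⟩, h⟩ := IsLocalizedModule.surj (nonZeroDivisors P) ι.toLinearMap s
    exact ⟨p, nonZeroDivisors.ne_zero hp, r, h⟩
  have hreg (p : P) (hp : p ≠ 0) (s : F ⊗[P] R) (h : p • s = 0) : s = 0 := by
    rw [← algebraMap_smul F p s] at h
    refine (smul_eq_zero.1 h).resolve_left ?_
    rwa [map_eq_zero_iff _ (IsFractionRing.injective P F)]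
  have : Nontrivial (F ⊗[P] R) := hι.nontrivial
  have : NoZeroDivisors (F ⊗[P] R) := ⟨fun {s t} hst => by
    obtain ⟨p, hp, r, hr⟩ := hfrac s
    obtain ⟨q, hq, r', hr'⟩ := hfrac t
    have h : ι (r * r') = 0 := by
      rw [map_mul, ← hr, ← hr', smul_mul_smul_comm, hst, smul_zero]
    rw [map_eq_zero_iff ι hι, mul_eq_zero] at h
    refine h.imp (fun h => hreg p hp s ?_) (fun h => hreg q hq t ?_)
    · rw [hr, h, map_zero]
    · rw [hr', h, map_zero]⟩
  refine ⟨F ⊗[P] R, inferInstance, inferInstance, NoZeroDivisors.to_isDomain _, ι.toRingHom,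
    fun p => ?_⟩
  exact (ι.commutes p).trans (IsScalarTower.algebraMap_apply P F _ p)

end Division

section SkewMonoidAlgebra

theorem noZeroDivisors_skewMonoidAlgebra {C M : Type*} [Ring C] [NoZeroDivisors C] [Monoid M]
    [UniqueProds M] [MulSemiringAction M C] (h : ∀ (m : M) (c : C), m • c = 0 → c = 0) :
    NoZeroDivisors (SkewMonoidAlgebra C M) where
  eq_zero_or_eq_zero_of_mul_eq_zero {f g} hfg := by
    classical
    contrapose! hfg
    simp only [ne_eq, ← SkewMonoidAlgebra.support_eq_empty, ← Finset.nonempty_iff_ne_empty] at hfg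
    obtain ⟨m, hm, n, hn, hu⟩ := UniqueProds.uniqueMul_of_nonempty hfg.1 hfg.2
    have key : (f * g).coeff (m * n) = f.coeff m * m • g.coeff n := by
      simp_rw [SkewMonoidAlgebra.coeff_mul, SkewMonoidAlgebra.sum_def, Finsupp.sum,
        ← Finset.sum_product']
      refine (Finset.sum_eq_single (m, n) (fun ab hab hne => if_neg fun he => ?_) ?_).trans
        (if_pos rfl)
      · rw [Finset.mem_product] at hab
        exact hne (Prod.ext (hu hab.1 hab.2 he).1 (hu hab.1 hab.2 he).2)
      · exact fun hmem => (hmem (Finset.mem_product.2 ⟨hm, hn⟩)).elim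
    intro h0
    rw [h0, SkewMonoidAlgebra.coeff_zero, Finsupp.zero_apply, eq_comm, mul_eq_zero] at key
    exact key.elim (SkewMonoidAlgebra.mem_support_iff.1 hm)
      fun e => SkewMonoidAlgebra.mem_support_iff.1 hn (h _ _ e)

end SkewMonoidAlgebra

section ShiftAlgebra

open MvPolynomial

variable (k : Type) [Field k]

/-- The shift automorphism `Xₙ ↦ Xₙ + mₙ` of `k[X₀, X₁]`. -/
def shift (m : Fin 2 → ℕ) : MvPolynomial (Fin 2) k →ₐ[k] MvPolynomial (Fin 2) k :=
  aeval fun n => X n + C (m n : k)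

variable {k}

@[simp]
theorem shift_X (m : Fin 2 → ℕ) (n : Fin 2) : shift k m (X n) = X n + C (m n : k) :=
  aeval_X _ _

@[simp]
theorem shift_C (m : Fin 2 → ℕ) (r : k) : shift k m (C r) = C r :=
  (shift k m).commutes r

theorem shift_zero : shift k 0 = AlgHom.id k _ := by
  ext n : 1
  simp

theorem shift_add (m n : Fin 2 → ℕ) : shift k (m + n) = (shift k m).comp (shift k n) := by
  ext i : 1
  simp [add_assoc]

theorem shift_injective (m : Fin 2 → ℕ) : Function.Injective (shift k m) := by
  let g : MvPolynomial (Fin 2) k →ₐ[k] MvPolynomial (Fin 2) k := aeval fun n => X n - C (m n : k)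
  have h : g.comp (shift k m) = AlgHom.id k _ := by
    ext n : 1
    simp [g]
  exact Function.LeftInverse.injective (g := g) fun f => DFunLike.congr_fun h f

instance : MulSemiringAction (Multiplicative (Fin 2 → ℕ)) (MvPolynomial (Fin 2) k) where
  smul m f := shift k m.toAdd f
  one_smul f := DFunLike.congr_fun shift_zero f
  mul_smul m n f := DFunLike.congr_fun (shift_add m.toAdd n.toAdd) f
  smul_zero m := map_zero (shift k m.toAdd)
  smul_add m := map_add (shift k m.toAdd)
  smul_one m := map_one (shift k m.toAdd)
  smul_mul m := map_mul (shift k m.toAdd)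

theorem smul_eq_shift (m : Multiplicative (Fin 2 → ℕ)) (f : MvPolynomial (Fin 2) k) :
    m • f = shift k m.toAdd f := rfl

variable (k) in
/-- The twisted monoid algebra of `ℕ²` over `k[X₀, X₁]`, with `ℕ²` acting by shifts. -/
abbrev ShiftAlgebra : Type :=
  SkewMonoidAlgebra (MvPolynomial (Fin 2) k) (Multiplicative (Fin 2 → ℕ))

namespace ShiftAlgebra

open SkewMonoidAlgebra

instance : IsDomain (ShiftAlgebra k) :=
  have := noZeroDivisors_skewMonoidAlgebra (C := MvPolynomial (Fin 2) k)
    (M := Multiplicative (Fin 2 → ℕ))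
    fun m _ h => (map_eq_zero_iff _ (shift_injective (k := k) m.toAdd)).1 h
  NoZeroDivisors.to_isDomain _

variable (k) in
/-- The generator `Xₙ`. -/
def genI (n : Fin 2) : ShiftAlgebra k := single 1 (X n)

variable (k) in
/-- The generator inducing the shift of the variable `Xₙ`. -/
def genJ (n : Fin 2) : ShiftAlgebra k := single (Multiplicative.ofAdd (Pi.single n 1)) 1

theorem genI_commute (m n : Fin 2) : Commute (genI k m) (genI k n) := by
  simp [commute_iff_eq, genI, single_mul_single, mul_comm]

theorem genJ_commute (m n : Fin 2) : Commute (genJ k m) (genJ k n) := by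
  simp [commute_iff_eq, genJ, single_mul_single, mul_comm]

theorem genJ_mul_genI (n : Fin 2) : genJ k n * genI k n = (genI k n + 1) * genJ k n := by
  simp [genJ, genI, single_mul_single, smul_eq_shift, add_mul, single_add]

theorem genJ_commute_genI {m n : Fin 2} (h : m ≠ n) : Commute (genJ k m) (genI k n) := by
  simp [commute_iff_eq, genJ, genI, single_mul_single, smul_eq_shift, h.symm]

/-- The central elements `Xₙ² - Xₙ`. -/
theorem genI_sq_sub (n : Fin 2) : genI k n * genI k n - genI k n = single 1 (X n ^ 2 - X n) := by
  simp [genI, single_mul_single, sub_eq_add_neg, single_add, pow_two]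

theorem genJ_pow (n : Fin 2) (e : ℕ) :
    genJ k n ^ e = single (Multiplicative.ofAdd (Pi.single n e)) 1 := by
  induction e with
  | zero => simp
  | succ e ih =>
    rw [pow_succ, ih, genJ, single_mul_single, smul_one, one_mul, ← ofAdd_add, ← Pi.single_add]

theorem commute_single {m : Multiplicative (Fin 2 → ℕ)} {c : MvPolynomial (Fin 2) k}
    (hm : ∀ f : MvPolynomial (Fin 2) k, m • f = f)
    (hc : ∀ n : Multiplicative (Fin 2 → ℕ), n • c = c) (r : ShiftAlgebra k) :
    Commute (single m c) r := by
  induction r using SkewMonoidAlgebra.induction_on with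
  | zero => exact Commute.zero_right _
  | single n f => simp [commute_iff_eq, single_mul_single, hm, hc, mul_comm]
  | add f g hf hg => exact hf.add_right hg

/-- The additive map identifying `ShiftAlgebra k` with a commutative polynomial ring. -/
def symbol : ShiftAlgebra k →+ MvPolynomial (Fin 4) k :=
  liftNC (aeval ![X 0, X 2] : MvPolynomial (Fin 2) k →ₐ[k] MvPolynomial (Fin 4) k).toAddMonoidHom
    fun m => X 1 ^ m.toAdd 0 * X 3 ^ m.toAdd 1

theorem symbol_single (m : Multiplicative (Fin 2 → ℕ)) (c : MvPolynomial (Fin 2) k) :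
    symbol (single m c) = aeval ![X 0, X 2] c * (X 1 ^ m.toAdd 0 * X 3 ^ m.toAdd 1) :=
  liftNC_single _ _ _ _

theorem symbol_single_mul {m : Multiplicative (Fin 2 → ℕ)} (c : MvPolynomial (Fin 2) k)
    (hm : ∀ f : MvPolynomial (Fin 2) k, m • f = f) (r : ShiftAlgebra k) :
    symbol (single m c * r) = symbol (single m c) * symbol r := by
  induction r using SkewMonoidAlgebra.induction_on with
  | zero => simp
  | single n f =>
    simp only [single_mul_single, hm, symbol_single, map_mul, toAdd_mul, Pi.add_apply, pow_add]
    ring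
  | add f g hf hg => rw [mul_add, map_add, hf, hg, map_add, mul_add]

variable (k) in
/-- Central elements of `ShiftAlgebra k`, algebraically independent over `k`. -/
def centralGen (e : Fin 2 → ℕ) : Fin 4 → ShiftAlgebra k :=
  ![genI k 0 * genI k 0 - genI k 0, genJ k 0 ^ (2 * e 0),
    genI k 1 * genI k 1 - genI k 1, genJ k 1 ^ (2 * e 1)]

theorem algebraicIndependent_symbol_centralGen {e : Fin 2 → ℕ} (he : ∀ n, e n ≠ 0) :
    AlgebraicIndependent k fun n => symbol (centralGen k e n) := by
  let q : Fin 4 → Polynomial k := ![.X ^ 2 - .X, .X ^ (2 * e 0), .X ^ 2 - .X, .X ^ (2 * e 1)]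
  have hq (n : Fin 4) : Transcendental k (q n) := by
    have h : (q n).natDegree ≠ 0 := by
      have h2 : (Polynomial.X ^ 2 - Polynomial.X : Polynomial k).natDegree = 2 := by
        compute_degree!
      fin_cases n <;> simp [q, h2, he]
    refine (q n).transcendental h (mem_nonZeroDivisors_of_ne_zero ?_)
    rw [Polynomial.leadingCoeff_ne_zero]
    rintro h0
    simp [h0] at h
  convert MvPolynomial.algebraicIndependent_polynomial_aeval_X q hq using 2 with n
  fin_cases n <;>
    simp [centralGen, q, genI_sq_sub, genJ_pow, symbol_single]

variable [CharP k 2]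

theorem smul_single_two_mul (n : Fin 2) (e : ℕ) (f : MvPolynomial (Fin 2) k) :
    Multiplicative.ofAdd (Pi.single n (2 * e) : Fin 2 → ℕ) • f = f := by
  have h : shift k (Pi.single n (2 * e)) = AlgHom.id k _ := by
    ext i : 1
    by_cases hi : i = n
    · subst hi; simp [CharTwo.two_eq_zero]
    · simp [hi]
  exact DFunLike.congr_fun h f

theorem smul_X_sq_sub_X (n : Fin 2) (m : Multiplicative (Fin 2 → ℕ)) :
    m • (X n ^ 2 - X n : MvPolynomial (Fin 2) k) = X n ^ 2 - X n := by
  have h : (C (m.toAdd n : k) : MvPolynomial (Fin 2) k) ^ 2 = C (m.toAdd n : k) := by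
    rw [← C_pow]
    congr 1
    rcases Nat.even_or_odd (m.toAdd n) with h | h
    · simp [(CharP.cast_eq_zero_iff k 2 _).2 h.two_dvd]
    · obtain ⟨r, hr⟩ := h
      simp [hr, CharTwo.two_eq_zero]
  rw [smul_eq_shift, map_sub, map_pow, shift_X, CharTwo.add_sq, h]
  ring

theorem exists_centralGen_eq_single (e : Fin 2 → ℕ) (n : Fin 4) :
    ∃ (m : Multiplicative (Fin 2 → ℕ)) (c : MvPolynomial (Fin 2) k),
      centralGen k e n = single m c ∧ (∀ f : MvPolynomial (Fin 2) k, m • f = f) ∧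
        ∀ n : Multiplicative (Fin 2 → ℕ), n • c = c := by
  fin_cases n
  · exact ⟨1, _, genI_sq_sub 0, one_smul _, smul_X_sq_sub_X 0⟩
  · exact ⟨_, 1, genJ_pow 0 _, smul_single_two_mul 0 (e 0), smul_one⟩
  · exact ⟨1, _, genI_sq_sub 1, one_smul _, smul_X_sq_sub_X 1⟩
  · exact ⟨_, 1, genJ_pow 1 _, smul_single_two_mul 1 (e 1), smul_one⟩

theorem centralGen_commute (e : Fin 2 → ℕ) (n : Fin 4) (r : ShiftAlgebra k) :
    Commute (centralGen k e n) r := by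
  obtain ⟨m, c, h, hm, hc⟩ := exists_centralGen_eq_single (k := k) e n
  exact h ▸ commute_single hm hc r

theorem symbol_centralGen_mul (e : Fin 2 → ℕ) (n : Fin 4) (r : ShiftAlgebra k) :
    symbol (centralGen k e n * r) = symbol (centralGen k e n) * symbol r := by
  obtain ⟨m, c, h, hm, -⟩ := exists_centralGen_eq_single (k := k) e n
  rw [h, symbol_single_mul c hm]

variable (k) in
/-- The scalars, as central elements. -/
def centerC : k →+* Subring.center (ShiftAlgebra k) where
  toFun r := ⟨single 1 (C r), Subring.mem_center_iff.2 fun s =>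
    (commute_single (one_smul _) (fun n => shift_C n.toAdd r) s).symm⟩
  map_one' := Subtype.ext (by simp)
  map_zero' := Subtype.ext (by simp)
  map_mul' r s := Subtype.ext (by simp [single_mul_single])
  map_add' r s := Subtype.ext (by simp [single_add])

variable (k) in
/-- The polynomial ring, embedded as the subring generated by permuted central generators. -/
def ofPoly (e : Fin 2 → ℕ) (π : Equiv.Perm (Fin 4)) : MvPolynomial (Fin 4) k →+* ShiftAlgebra k :=
  (Subring.center (ShiftAlgebra k)).subtype.comp
    (eval₂Hom (centerC k) fun n => (⟨centralGen k e (π n), Subring.mem_center_iff.2 fun s =>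
      (centralGen_commute e (π n) s).symm⟩ : Subring.center (ShiftAlgebra k)))

theorem ofPoly_X (e : Fin 2 → ℕ) (π : Equiv.Perm (Fin 4)) (n : Fin 4) :
    ofPoly k e π (X n) = centralGen k e (π n) := by
  simp [ofPoly]

theorem ofPoly_C (e : Fin 2 → ℕ) (π : Equiv.Perm (Fin 4)) (r : k) :
    ofPoly k e π (C r) = single 1 (C r) := by
  simp [ofPoly, centerC]

theorem ofPoly_commute (e : Fin 2 → ℕ) (π : Equiv.Perm (Fin 4)) (p : MvPolynomial (Fin 4) k)
    (r : ShiftAlgebra k) : Commute (ofPoly k e π p) r :=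
  (Subring.mem_center_iff.1 (Subtype.prop _) r).symm

theorem symbol_ofPoly_mul (e : Fin 2 → ℕ) (π : Equiv.Perm (Fin 4)) (p : MvPolynomial (Fin 4) k)
    (r : ShiftAlgebra k) : symbol (ofPoly k e π p * r) =
      aeval (fun n => symbol (centralGen k e (π n))) p * symbol r := by
  induction p using MvPolynomial.induction_on generalizing r with
  | C a => simp [ofPoly_C, symbol_single_mul, symbol_single]
  | add p q hp hq => simp [add_mul, hp, hq]
  | mul_X p n hp => simp [mul_assoc, hp, ofPoly_X, symbol_centralGen_mul]

theorem ofPoly_injective {e : Fin 2 → ℕ} (he : ∀ n, e n ≠ 0) (π : Equiv.Perm (Fin 4)) :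
    Function.Injective (ofPoly k e π) := by
  refine (injective_iff_map_eq_zero _).2 fun p hp => ?_
  have h := symbol_ofPoly_mul e π p 1
  rw [hp, zero_mul, map_zero, SkewMonoidAlgebra.one_def, symbol_single] at h
  have hi := (algebraicIndependent_symbol_centralGen (k := k) he).comp π π.injective
  refine (map_eq_zero_iff _ hi).1 ?_
  exact (h.trans (by simp [Function.comp_def])).symm

end ShiftAlgebra

end ShiftAlgebra

section RatFun4

open MvPolynomial

variable {k}

instance : IsFractionRing (MvPolynomial (Fin 4) k) (RatFun4 k) :=
  inferInstanceAs (IsFractionRing _ (FractionRing _))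

theorem var_ne_zero (n : Fin 4) : var k n ≠ 0 :=
  (map_ne_zero_iff _ (IsFractionRing.injective (MvPolynomial (Fin 4) k) (RatFun4 k))).2
    (X_ne_zero n)

variable [CharP k 2]

instance : CharP (RatFun4 k) 2 :=
  charP_of_injective_algebraMap (IsFractionRing.injective (MvPolynomial (Fin 4) k) (RatFun4 k)) 2

theorem exists_isDomain_shiftAlgebra {e : Fin 2 → ℕ} (he : ∀ n, e n ≠ 0)
    (π : Equiv.Perm (Fin 4)) :
    ∃ (S : Type) (_ : Ring S) (_ : Algebra (RatFun4 k) S) (_ : IsDomain S)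
      (ι : ShiftAlgebra k →+* S),
      ∀ n, ι (ShiftAlgebra.centralGen k e n) = algebraMap (RatFun4 k) S (var k (π n)) := by
  obtain ⟨S, _, _, _, ι, h⟩ := exists_isDomain_algebra_fractionRing (F := RatFun4 k)
    (ShiftAlgebra.ofPoly k e π.symm) (ShiftAlgebra.ofPoly_injective he _)
    (ShiftAlgebra.ofPoly_commute e _)
  refine ⟨S, ‹_›, ‹_›, ‹_›, ι, fun n => ?_⟩
  rw [var, ← h, ShiftAlgebra.ofPoly_X, Equiv.symm_apply_apply]

theorem isDivision_tensor (π : Equiv.Perm (Fin 4)) :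
    IsDivision (QuatAlg (RatFun4 k) (var k (π 0)) (var k (π 1)) ⊗[RatFun4 k]
      QuatAlg (RatFun4 k) (var k (π 2)) (var k (π 3))) := by
  obtain ⟨S, _, _, _, ι, h⟩ := exists_isDomain_shiftAlgebra (k := k) (e := 1) (by simp) π
  have h2 : CharP S 2 := charP_of_injective_algebraMap (algebraMap (RatFun4 k) S).injective 2
  have hI (n : Fin 2) {c : S}
      (hc : ι (ShiftAlgebra.genI k n * ShiftAlgebra.genI k n - ShiftAlgebra.genI k n) = c) :
      ι (ShiftAlgebra.genI k n) * ι (ShiftAlgebra.genI k n) = ι (ShiftAlgebra.genI k n) + c := by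
    rw [← hc, map_sub, map_mul, add_sub_cancel]
  have hJ (n : Fin 2) {c : S} (hc : ι (ShiftAlgebra.genJ k n ^ 2) = c) :
      ι (ShiftAlgebra.genJ k n) * ι (ShiftAlgebra.genJ k n) = c := by
    rw [← hc, map_pow, pow_two]
  have hJI (n : Fin 2) : ι (ShiftAlgebra.genJ k n) * ι (ShiftAlgebra.genI k n) =
      (1 - ι (ShiftAlgebra.genI k n)) * ι (ShiftAlgebra.genJ k n) := by
    rw [← map_mul, ShiftAlgebra.genJ_mul_genI, map_mul, map_add, map_one, CharTwo.sub_eq_add,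
      add_comm 1]
  obtain ⟨f, hf⟩ := QuatAlg.exists_injective_tensor (var_ne_zero (k := k) (π 1))
    (var_ne_zero (k := k) (π 3))
    (hI 0 (h 0)) (hJ 0 (h 1)) (hJI 0) (hI 1 (h 2)) (hJ 1 (h 3)) (hJI 1)
    ((ShiftAlgebra.genI_commute 0 1).map ι)
    ((ShiftAlgebra.genJ_commute_genI (by decide)).symm.map ι)
    ((ShiftAlgebra.genJ_commute_genI (by decide)).map ι) ((ShiftAlgebra.genJ_commute 0 1).map ι)
  exact isDivision_of_injective f hf

theorem isDivision_quatAlg_add_mul :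
    IsDivision (QuatAlg (RatFun4 k) (var k 0 + var k 2) (var k 1 * var k 3)) := by
  obtain ⟨S, _, _, _, ι, h⟩ := exists_isDomain_shiftAlgebra (k := k) (e := ![1, 2])
    (by simp [Fin.forall_fin_two]) 1
  have h2 : CharP S 2 := charP_of_injective_algebraMap (algebraMap (RatFun4 k) S).injective 2
  let i (n : Fin 2) : S := ι (ShiftAlgebra.genI k n)
  let j (n : Fin 2) : S := ι (ShiftAlgebra.genJ k n)
  have hi₀ : i 0 * i 0 - i 0 = algebraMap _ S (var k 0) := by
    simpa [ShiftAlgebra.centralGen, i] using h 0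
  have hi₁ : i 1 * i 1 - i 1 = algebraMap _ S (var k 2) := by
    simpa [ShiftAlgebra.centralGen, i] using h 2
  have hj₀ : j 0 ^ 2 = algebraMap _ S (var k 1) := by
    simpa [ShiftAlgebra.centralGen, j] using h 1
  have hj₁ : j 1 ^ 4 = algebraMap _ S (var k 3) := by
    simpa [ShiftAlgebra.centralGen, j] using h 3
  have hji (n : Fin 2) : j n * i n = (i n + 1) * j n := by
    simp only [i, j, ← map_mul, ShiftAlgebra.genJ_mul_genI, ← map_one ι, ← map_add]
  have hii : Commute (i 0) (i 1) := (ShiftAlgebra.genI_commute 0 1).map ι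
  have hjj : Commute (j 0) (j 1) := (ShiftAlgebra.genJ_commute 0 1).map ι
  have h₀₁ : Commute (j 0) (i 1) := (ShiftAlgebra.genJ_commute_genI (by decide)).map ι
  have h₁₀ : Commute (j 1) (i 0) := (ShiftAlgebra.genJ_commute_genI (by decide)).map ι
  have h₁₁ : Commute (j 1 ^ 2) (i 1) := by
    rw [commute_iff_eq, pow_two, mul_assoc, hji, ← mul_assoc, mul_add, hji, mul_one, add_one_mul,
      add_assoc, CharTwo.add_self_eq_zero, add_zero, mul_assoc]
  have hx : (i 0 + i 1) * (i 0 + i 1) = i 0 + i 1 + algebraMap _ S (var k 0 + var k 2) := by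
    calc
      _ = i 0 * i 0 + i 1 * i 1 + (i 0 * i 1 + i 1 * i 0) := by noncomm_ring
      _ = i 0 * i 0 + i 1 * i 1 := by rw [hii.eq, CharTwo.add_self_eq_zero, add_zero]
      _ = _ := by rw [map_add, ← hi₀, ← hi₁]; abel
  have hy : (j 0 * j 1 ^ 2) * (j 0 * j 1 ^ 2) = algebraMap _ S (var k 1 * var k 3) := by
    rw [(hjj.symm.pow_left 2).mul_mul_mul_comm, ← pow_two, ← pow_add, hj₀, hj₁, map_mul]
  have hyx : (j 0 * j 1 ^ 2) * (i 0 + i 1) = (1 - (i 0 + i 1)) * (j 0 * j 1 ^ 2) := by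
    rw [mul_add, mul_assoc, mul_assoc, (h₁₀.pow_left 2).eq, h₁₁.eq, ← mul_assoc, ← mul_assoc, hji,
      h₀₁.eq, CharTwo.sub_eq_add]
    noncomm_ring
  exact isDivision_of_injective (QuatAlg.lift _ _ hx hy hyx) (QuatAlg.injective_of_algHom _
    (mul_ne_zero (var_ne_zero 1) (var_ne_zero 3)))

end RatFun4

/-- part of Example 4.5 of the paper.  Over
`k' = k(X₁,Y₁,X₂,Y₂)`, `k` of characteristic 2, with
`Q₁ = [X₁+X₂, Y₁)`, `Q₂ = [X₁+X₂, Y₂)`, `Q₃ = [X₁, Y₁Y₂)`, `Q₄ = [X₂, Y₁Y₂)` and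
`Q = [X₁+X₂, Y₁Y₂)`: the algebra `Q` is division, `Q₁ ⊗ Q₂ ∼ Q ∼ Q₃ ⊗ Q₄`, and with
`B⁺ = [X₁,Y₂) ⊗ [X₂,Y₁)`, `B⁻ = [X₁,Y₁) ⊗ [X₂,Y₂)`, the algebras `B⁺`, `B⁻` are
division and `B⁺ ⊗ B⁻ ∼ Q`. -/
theorem quaternion_example (hchar : ringChar k = 2) :
    IsDivision (QuatAlg (RatFun4 k) (var k 0 + var k 2) (var k 1 * var k 3)) ∧
    BrauerEquiv (RatFun4 k)
      (QuatAlg (RatFun4 k) (var k 0 + var k 2) (var k 1) ⊗[RatFun4 k]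
        QuatAlg (RatFun4 k) (var k 0 + var k 2) (var k 3))
      (QuatAlg (RatFun4 k) (var k 0 + var k 2) (var k 1 * var k 3)) ∧
    BrauerEquiv (RatFun4 k)
      (QuatAlg (RatFun4 k) (var k 0) (var k 1 * var k 3) ⊗[RatFun4 k]
        QuatAlg (RatFun4 k) (var k 2) (var k 1 * var k 3))
      (QuatAlg (RatFun4 k) (var k 0 + var k 2) (var k 1 * var k 3)) ∧
    IsDivision (QuatAlg (RatFun4 k) (var k 0) (var k 3) ⊗[RatFun4 k]
      QuatAlg (RatFun4 k) (var k 2) (var k 1)) ∧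
    IsDivision (QuatAlg (RatFun4 k) (var k 0) (var k 1) ⊗[RatFun4 k]
      QuatAlg (RatFun4 k) (var k 2) (var k 3)) ∧
    BrauerEquiv (RatFun4 k)
      ((QuatAlg (RatFun4 k) (var k 0) (var k 3) ⊗[RatFun4 k]
          QuatAlg (RatFun4 k) (var k 2) (var k 1)) ⊗[RatFun4 k]
        (QuatAlg (RatFun4 k) (var k 0) (var k 1) ⊗[RatFun4 k]
          QuatAlg (RatFun4 k) (var k 2) (var k 3)))
      (QuatAlg (RatFun4 k) (var k 0 + var k 2) (var k 1 * var k 3)) := by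
  have : CharP k 2 := ringChar.of_eq hchar
  exact ⟨isDivision_quatAlg_add_mul,
    (QuatAlg.isMatrixAlgOver_tensor_left (var_ne_zero 1) (var_ne_zero 3)).brauerEquiv,
    (QuatAlg.isMatrixAlgOver_tensor_right
      (mul_ne_zero (var_ne_zero 1) (var_ne_zero 3))).brauerEquiv,
    isDivision_tensor (Equiv.swap 1 3), isDivision_tensor 1,
    (QuatAlg.isMatrixAlgOver_tensor_tensor (var_ne_zero 1) (var_ne_zero 3)).brauerEquiv⟩

end

end Triality
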